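/- Let l : ℝ → ℝ belong to the class 𝐋. Then there exist real numbers ū₁, ū₂ with 0 < ū₁ < ū₂ such that sup{ l(u) : |u| ≤ ū₁ } < inf{ l(u) : |u| > ū₂ }. -/

import Mathlib

/-- The class 𝐋 of loss functions: nonnegative, vanishing exactly at 0,
continuous at 0, convex, with polynomial growth `l r ≤ 1 + |r|^m` for some `m > 0`. -/
def MemLossClassL (l : ℝ → ℝ) : Prop :=
  (∀ r : ℝ, 0 ≤ l r) ∧ (∀ r : ℝ, l r = 0 ↔ r = 0) ∧ ContinuousAt l 0 ∧
    ConvexOn ℝ Set.univ l ∧ ∃ m : ℝ, 0 < m ∧ ∀ r : ℝ, l r ≤ 1 + |r| ^ m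

/-- Separation property of loss functions in 𝐋: there exist `0 < ū₁ < ū₂` with
`sup { l u : |u| ≤ ū₁ } < inf { l u : |u| > ū₂ }`. -/
theorem lossClass_separation (l : ℝ → ℝ) (hl : MemLossClassL l) :
    ∃ u1 u2 : ℝ, 0 < u1 ∧ u1 < u2 ∧
      sSup (l '' {u : ℝ | |u| ≤ u1}) < sInf (l '' {u : ℝ | u2 < |u|}) := by
  obtain ⟨h0, hz, hc, hconv, -⟩ := hl
  have hl0 : l 0 = 0 := (hz 0).2 rfl
  have h1 : 0 < l 1 := lt_of_le_of_ne (h0 1) (fun h => one_ne_zero ((hz 1).1 h.symm))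
  have h2 : 0 < l (-1) :=
    lt_of_le_of_ne (h0 (-1)) (fun h => by have := (hz (-1)).1 h.symm; norm_num at this)
  obtain ⟨c, hcpos, hc1, hc2⟩ : ∃ c : ℝ, 0 < c ∧ c ≤ l 1 ∧ c ≤ l (-1) :=
    ⟨min (l 1) (l (-1)), lt_min h1 h2, min_le_left _ _, min_le_right _ _⟩
  have key : ∀ u t : ℝ, 0 < t → t ≤ 1 → l (t * u) ≤ l u := by
    intro u t ht ht1
    have h := hconv.2 (Set.mem_univ u) (Set.mem_univ 0) ht.le (sub_nonneg.2 ht1) (by ring)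
    simp only [smul_eq_mul, mul_zero, add_zero, hl0] at h
    nlinarith [h0 u]
  obtain ⟨δ, hδ, hball⟩ := Metric.continuousAt_iff.1 hc (c / 2) (by linarith)
  refine ⟨min (δ / 2) (1 / 2), 1, by positivity, ?_, ?_⟩
  · exact lt_of_le_of_lt (min_le_right _ _) (by norm_num)
  have hsup : sSup (l '' {u : ℝ | |u| ≤ min (δ / 2) (1 / 2)}) ≤ c / 2 := by
    apply csSup_le
    · exact ⟨l 0, 0, by simp only [Set.mem_setOf_eq, abs_zero]; positivity, rfl⟩
    · rintro _ ⟨u, hu, rfl⟩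
      have hu' : |u| ≤ δ / 2 := le_trans hu (min_le_left _ _)
      have h := @hball u (by rw [Real.dist_eq, sub_zero]; linarith)
      rw [Real.dist_eq, hl0, sub_zero] at h
      exact (le_abs_self _).trans h.le
  have hinf : c ≤ sInf (l '' {u : ℝ | 1 < |u|}) := by
    apply le_csInf
    · exact ⟨l 2, 2, by simp only [Set.mem_setOf_eq]; norm_num, rfl⟩
    · rintro _ ⟨u, hu, rfl⟩
      have hu' : 1 < |u| := hu
      have hk := key u |u|⁻¹ (by positivity) (inv_le_one_of_one_le₀ hu'.le)
      rcases le_total 0 u with hs | hs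
      · rw [abs_of_nonneg hs] at hk hu'
        rw [inv_mul_cancel₀ (by linarith)] at hk
        linarith
      · rw [abs_of_nonpos hs] at hk hu'
        have e : (-u)⁻¹ * u = -1 := by
          have : u ≠ 0 := by intro h; rw [h] at hu'; norm_num at hu'
          field_simp
        rw [e] at hk
        linarith
  linarith
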